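/- arXiv:2201.11969 — 3 statements merged into one kernel-verified Lean document; each statement's English description precedes it below -/
import Mathlib

section
/- Let G be a group acting on normed vector spaces X and Y via norm-preserving representations ρ_X and ρ_Y. Let f : X → Y have equivariance error ‖f‖_EE (the supremum over g ∈ G and x ∈ X of ‖f(ρ_X(g)x) − ρ_Y(g)f(x)‖), and assume this supremum is attained at some x* ∈ X and g* ∈ G. If f_θ : X → Y is G-equivariant, then there exists x₀ ∈ X such that ‖f(x₀) − f_θ(x₀)‖ ≥ ‖f‖_EE / 2. -/
/-- If the equivariance error (supremum of the equivariance defect) of `f` is attained,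
i.e. `M` is the greatest value of the defect, then any strictly `G`-equivariant
approximator `fθ` of `f` makes an error of at least `M / 2` at some point. -/
theorem exists_error_ge_half_equivariance_error
    {G X Y : Type*} [Group G]
    [NormedAddCommGroup X] [NormedSpace ℝ X]
    [NormedAddCommGroup Y] [NormedSpace ℝ Y]
    (ρX : G →* (X ≃ₗᵢ[ℝ] X)) (ρY : G →* (Y ≃ₗᵢ[ℝ] Y))
    (f fθ : X → Y)
    (hθ : ∀ (g : G) (x : X), fθ (ρX g x) = ρY g (fθ x))
    (M : ℝ)
    (hM : IsGreatest
      (Set.range fun p : G × X => ‖f (ρX p.1 p.2) - ρY p.1 (f p.2)‖) M) :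
    ∃ x₀ : X, ‖f x₀ - fθ x₀‖ ≥ M / 2 := by
  obtain ⟨⟨⟨g, x⟩, rfl⟩, -⟩ := hM
  by_contra! h
  have h₁ := h (ρX g x)
  have h₂ := h x
  have htri := norm_sub_le_norm_sub_add_norm_sub (f (ρX g x)) (fθ (ρX g x)) (ρY g (f x))
  have hiso : ‖fθ (ρX g x) - ρY g (f x)‖ = ‖f x - fθ x‖ := by
    rw [hθ, ← map_sub, LinearIsometryEquiv.norm_map, norm_sub_rev]
  dsimp only at h₁ h₂
  linarith
end

section
/- Let G be a group acting on normed vector spaces X and Y via norm-preserving representations ρ_X and ρ_Y. Let f, f_θ : X → Y, suppose ‖f(x) − f_θ(x)‖ ≤ c for all x ∈ X, suppose the equivariance errors ‖f‖_EE and ‖f_θ‖_EE (suprema over g ∈ G, x ∈ X of the equivariance defect) are finite, and suppose ‖f‖_EE = ε. Then |‖f‖_EE − ‖f_θ‖_EE| ≤ 2c + ε. -/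
/-- Replacing `f` by a function uniformly within `c` of it increases the equivariance defect
at a given point by at most `2c`. -/
theorem norm_equivariance_defect_le
    {X Y : Type*} [SeminormedAddCommGroup Y] [Module ℝ Y]
    (a : X → X) (b : Y ≃ₗᵢ[ℝ] Y) {f h : X → Y} {c : ℝ}
    (hc : ∀ x : X, ‖f x - h x‖ ≤ c) (x : X) :
    ‖h (a x) - b (h x)‖ ≤ ‖f (a x) - b (f x)‖ + 2 * c := by
  have key : h (a x) - b (h x) =
      (f (a x) - b (f x)) - (f (a x) - h (a x)) + b (f x - h x) := by
    rw [map_sub]; abel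
  calc ‖h (a x) - b (h x)‖
      ≤ ‖f (a x) - b (f x)‖ + ‖f (a x) - h (a x)‖ + ‖b (f x - h x)‖ :=
        key ▸ (norm_add_le _ _).trans (by gcongr; exact norm_sub_le _ _)
    _ ≤ ‖f (a x) - b (f x)‖ + 2 * c := by
        rw [b.norm_map]
        linarith [hc x, hc (a x)]

/-- If `fθ` approximates `f` uniformly within `c`, the equivariance errors
(suprema of the equivariance defects) of `f` and `fθ` are finite, and the
equivariance error of `f` equals `ε`, then the two equivariance errors differ
by at most `2c + ε`. -/
theorem abs_sub_equivariance_errors_le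
    {G X Y : Type*} [Group G]
    [NormedAddCommGroup X] [NormedSpace ℝ X]
    [NormedAddCommGroup Y] [NormedSpace ℝ Y]
    (ρX : G →* (X ≃ₗᵢ[ℝ] X)) (ρY : G →* (Y ≃ₗᵢ[ℝ] Y))
    (f fθ : X → Y) (c ε : ℝ)
    (hc : ∀ x : X, ‖f x - fθ x‖ ≤ c)
    (hbddf : BddAbove
      (Set.range fun p : G × X => ‖f (ρX p.1 p.2) - ρY p.1 (f p.2)‖))
    (hbddθ : BddAbove
      (Set.range fun p : G × X => ‖fθ (ρX p.1 p.2) - ρY p.1 (fθ p.2)‖))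
    (hε : (⨆ p : G × X, ‖f (ρX p.1 p.2) - ρY p.1 (f p.2)‖) = ε) :
    |(⨆ p : G × X, ‖f (ρX p.1 p.2) - ρY p.1 (f p.2)‖) -
        (⨆ p : G × X, ‖fθ (ρX p.1 p.2) - ρY p.1 (fθ p.2)‖)| ≤ 2 * c + ε := by
  have hε_nonneg : 0 ≤ ε := hε ▸ Real.iSup_nonneg fun _ => norm_nonneg _
  have hf : (⨆ p : G × X, ‖f (ρX p.1 p.2) - ρY p.1 (f p.2)‖) ≤
      (⨆ p : G × X, ‖fθ (ρX p.1 p.2) - ρY p.1 (fθ p.2)‖) + 2 * c :=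
    ciSup_le fun p =>
      (norm_equivariance_defect_le (ρX p.1) (ρY p.1)
        (fun x => norm_sub_rev (f x) (fθ x) ▸ hc x) p.2).trans
        (add_le_add_left (le_ciSup hbddθ p) _)
  have hθ : (⨆ p : G × X, ‖fθ (ρX p.1 p.2) - ρY p.1 (fθ p.2)‖) ≤
      (⨆ p : G × X, ‖f (ρX p.1 p.2) - ρY p.1 (f p.2)‖) + 2 * c :=
    ciSup_le fun p =>
      (norm_equivariance_defect_le (ρX p.1) (ρY p.1) hc p.2).trans
        (add_le_add_left (le_ciSup hbddf p) _)
  rw [abs_sub_le_iff]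
  constructor <;> linarith
end

section
/- Let H be a subgroup of O(2) acting on ℝ² by matrix multiplication, and let ρ_in : H → GL(c_in, ℝ) and ρ_out : H → GL(c_out, ℝ) be representations. Let Φ : ℝ² → ℝ^{c_out × c_in} be a kernel satisfying the steerability constraint Φ(hx) = ρ_out(h) Φ(x) ρ_in(h)⁻¹ for all h ∈ H and x ∈ ℝ². For an integrable feature map f : ℝ² → ℝ^{c_in}, define the convolution (f ⋆ Φ)(x) = ∫_{ℝ²} Φ(y) f(x + y) dy (Lebesgue integral), and let H act on input feature maps by (h·f)(x) = ρ_in(h) f(h⁻¹x). Then, assuming Φ is bounded and measurable and f is integrable, the convolution is H-equivariant: for all h ∈ H and x ∈ ℝ², ((h·f) ⋆ Φ)(x) = ρ_out(h) · (f ⋆ Φ)(h⁻¹x). -/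
open MeasureTheory

/-- Convolution of a feature map `f : ℝ² → ℝ^{c_in}` with a matrix-valued kernel
`Φ : ℝ² → ℝ^{c_out × c_in}`: `(f ⋆ Φ)(x) = ∫ Φ(y) f(x + y) dy`. -/
noncomputable def steerConv {cin cout : ℕ}
    (Φ : (Fin 2 → ℝ) → Matrix (Fin cout) (Fin cin) ℝ)
    (f : (Fin 2 → ℝ) → (Fin cin → ℝ)) (x : Fin 2 → ℝ) : Fin cout → ℝ :=
  ∫ y : Fin 2 → ℝ, (Φ y).mulVec (f (x + y))

theorem measurePreserving_mulVec_orthogonalGroup {n : Type*} [Fintype n] [DecidableEq n]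
    (A : Matrix.orthogonalGroup n ℝ) :
    MeasurePreserving (fun v : n → ℝ => (A : Matrix n n ℝ).mulVec v) := by
  have hdet : |(A : Matrix n n ℝ).det| = 1 := by
    have h := congrArg Matrix.det ((Matrix.mem_orthogonalGroup_iff n ℝ).1 A.2)
    rw [Matrix.det_mul, Matrix.det_transpose, Matrix.det_one, ← abs_mul_abs_self] at h
    nlinarith [abs_nonneg (A : Matrix n n ℝ).det]
  refine ⟨(Matrix.toLin' (A : Matrix n n ℝ)).continuous_of_finiteDimensional.measurable, ?_⟩
  have hne : (A : Matrix n n ℝ).det ≠ 0 := fun h => by simp [h] at hdet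
  have h := Real.map_matrix_volume_pi_eq_smul_volume_pi hne
  rw [abs_inv, hdet, inv_one, ENNReal.ofReal_one, one_smul] at h
  exact h

theorem measurableEmbedding_mulVec_orthogonalGroup {n : Type*} [Fintype n] [DecidableEq n]
    (A : Matrix.orthogonalGroup n ℝ) :
    MeasurableEmbedding (fun v : n → ℝ => (A : Matrix n n ℝ).mulVec v) :=
  (Matrix.toLin' (A : Matrix n n ℝ)).continuous_of_finiteDimensional.measurableEmbedding
    (Matrix.mulVec_injective_of_isUnit ⟨Unitary.toUnits A, rfl⟩)

theorem integral_mulVec_of_GL {α : Type*} [MeasurableSpace α] {n : Type*} [Fintype n]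
    [DecidableEq n] (μ : Measure α) (A : GL n ℝ) (g : α → n → ℝ) :
    ∫ y, (A : Matrix n n ℝ).mulVec (g y) ∂μ = (A : Matrix n n ℝ).mulVec (∫ y, g y ∂μ) :=
  (Matrix.GeneralLinearGroup.toLin A).toLinearEquiv.toContinuousLinearEquiv.integral_comp_comm g

/-- If the kernel `Φ` satisfies the steerability constraint
`Φ(hx) = ρ_out(h) Φ(x) ρ_in(h)⁻¹` for a subgroup `H ⊆ O(2)`, then the convolution
`f ⋆ Φ` is `H`-equivariant: `((h·f) ⋆ Φ)(x) = ρ_out(h) (f ⋆ Φ)(h⁻¹x)`, where `H` acts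
on input feature maps by `(h·f)(x) = ρ_in(h) f(h⁻¹x)`. -/
theorem steerConv_equivariant {cin cout : ℕ}
    (H : Subgroup (Matrix.orthogonalGroup (Fin 2) ℝ))
    (ρin : H →* GL (Fin cin) ℝ) (ρout : H →* GL (Fin cout) ℝ)
    (Φ : (Fin 2 → ℝ) → Matrix (Fin cout) (Fin cin) ℝ)
    (hsteer : ∀ (h : H) (x : Fin 2 → ℝ),
      Φ (((h : Matrix.orthogonalGroup (Fin 2) ℝ) : Matrix (Fin 2) (Fin 2) ℝ).mulVec x) =
        (ρout h : Matrix (Fin cout) (Fin cout) ℝ) * Φ x *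
          ((ρin h)⁻¹ : Matrix (Fin cin) (Fin cin) ℝ))
    (hΦmeas : ∀ (i : Fin cout) (j : Fin cin), Measurable fun y => Φ y i j)
    (hΦbdd : ∃ C : ℝ, ∀ (y : Fin 2 → ℝ) (i : Fin cout) (j : Fin cin), |Φ y i j| ≤ C)
    (f : (Fin 2 → ℝ) → (Fin cin → ℝ)) (hf : Integrable f)
    (h : H) (x : Fin 2 → ℝ) :
    steerConv Φ
        (fun z => (ρin h : Matrix (Fin cin) (Fin cin) ℝ).mulVec
          (f ((((h⁻¹ : H) : Matrix.orthogonalGroup (Fin 2) ℝ) :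
              Matrix (Fin 2) (Fin 2) ℝ).mulVec z))) x =
      (ρout h : Matrix (Fin cout) (Fin cout) ℝ).mulVec
        (steerConv Φ f ((((h⁻¹ : H) : Matrix.orthogonalGroup (Fin 2) ℝ) :
            Matrix (Fin 2) (Fin 2) ℝ).mulVec x)) := by
  have hinv (v : Fin 2 → ℝ) :
      (((h⁻¹ : H) : Matrix.orthogonalGroup (Fin 2) ℝ) : Matrix (Fin 2) (Fin 2) ℝ).mulVec
        (((h : Matrix.orthogonalGroup (Fin 2) ℝ) : Matrix (Fin 2) (Fin 2) ℝ).mulVec v) = v := by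
    rw [Matrix.mulVec_mulVec, ← Submonoid.coe_mul, ← Subgroup.coe_mul, inv_mul_cancel]
    simp
  unfold steerConv
  rw [← integral_mulVec_of_GL,
    ← (measurePreserving_mulVec_orthogonalGroup
      (h : Matrix.orthogonalGroup (Fin 2) ℝ)).integral_comp
      (measurableEmbedding_mulVec_orthogonalGroup _)]
  refine integral_congr_ae (.of_forall fun y => ?_)
  have hρ : ((ρin h)⁻¹ : Matrix (Fin cin) (Fin cin) ℝ) *
      (ρin h : Matrix (Fin cin) (Fin cin) ℝ) = 1 :=
    Matrix.nonsing_inv_mul _ ((Matrix.isUnit_iff_isUnit_det _).1 (ρin h).isUnit)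
  simp only
  rw [hsteer, Matrix.mulVec_add, hinv, Matrix.mulVec_mulVec, Matrix.mul_assoc, hρ,
    Matrix.mul_one, Matrix.mulVec_mulVec]
end
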